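/- arXiv:1912.01600 — 5 statements merged into one kernel-verified Lean document; each statement's English description precedes it below -/
import Mathlib

section
/- For any positive integers n, d ≥ 1, any simple graph on n vertices with maximum degree at most d has at most q·C(d+1,3) + C(r,3) triangles, where n = q(d+1) + r with 0 ≤ r ≤ d. -/
open Finset in
theorem choose_three_convex (s x y : ℕ) :
    (s + x).choose 3 + (s + y).choose 3 ≤ (s + x + y).choose 3 + s.choose 3 := by
  induction y with
  | zero => simp
  | succ y ih =>
    have h1 : (s + (y + 1)).choose 3 = (s + y).choose 2 + (s + y).choose 3 :=
      Nat.choose_succ_succ (s + y) 2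
    have h2 : (s + x + (y + 1)).choose 3 = (s + x + y).choose 2 + (s + x + y).choose 3 :=
      Nat.choose_succ_succ (s + x + y) 2
    have h3 : (s + y).choose 2 ≤ (s + x + y).choose 2 := Nat.choose_le_choose 2 (by omega)
    omega

/-- The extremal bound. -/
def triBound (d n : ℕ) : ℕ := n / (d + 1) * (d + 1).choose 3 + (n % (d + 1)).choose 3

theorem triBound_eq (d q r : ℕ) (hr : r ≤ d) :
    triBound d (q * (d + 1) + r) = q * (d + 1).choose 3 + r.choose 3 := by
  unfold triBound
  have h1 : (q * (d + 1) + r) / (d + 1) = q := by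
    rw [add_comm, Nat.add_mul_div_right _ _ (by omega), Nat.div_eq_of_lt (by omega), zero_add]
  have h2 : (q * (d + 1) + r) % (d + 1) = r := by
    rw [add_comm, Nat.add_mul_mod_self_right, Nat.mod_eq_of_lt (by omega)]
  rw [h1, h2]

theorem triBound_add (d m k : ℕ) (hk : k ≤ d + 1) :
    triBound d m + k.choose 3 ≤ triBound d (m + k) := by
  obtain ⟨q, r, hr, rfl⟩ : ∃ q r, r ≤ d ∧ m = q * (d + 1) + r :=
    ⟨m / (d + 1), m % (d + 1), Nat.le_of_lt_succ (Nat.mod_lt _ (by omega)),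
      (Nat.div_add_mod' m (d + 1)).symm⟩
  rw [triBound_eq d q r hr]
  by_cases h : r + k ≤ d
  · rw [add_assoc (q * (d + 1)), triBound_eq d q (r + k) h]
    have := choose_three_convex 0 r k
    simp at this
    omega
  · obtain ⟨s, hs⟩ : ∃ s, r + k = d + 1 + s := ⟨r + k - (d + 1), by omega⟩
    have e : q * (d + 1) + r + k = (q + 1) * (d + 1) + s := by
      rw [add_assoc, hs]; ring
    rw [e, triBound_eq d (q + 1) s (by omega)]
    obtain ⟨x, rfl⟩ : ∃ x, r = s + x := ⟨r - s, by omega⟩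
    obtain ⟨y, rfl⟩ : ∃ y, k = s + y := ⟨k - s, by omega⟩
    have := choose_three_convex s x y
    have e2 : s + x + y = d + 1 := by omega
    rw [e2] at this
    rw [add_mul]
    omega

open Finset in
/-- Each 3-set is listed by exactly six ordered triples. -/
theorem sum_triples {V : Type*} [DecidableEq V] (S : Finset V) (A : Finset (Finset V))
    (hA : A ⊆ S.powersetCard 3) :
    ∑ u ∈ S, ∑ v ∈ S, ∑ w ∈ S, (if ({u, v, w} : Finset V) ∈ A then 1 else 0) = 6 * #A := by
  have h1 : ∑ u ∈ S, ∑ v ∈ S, ∑ w ∈ S, (if ({u, v, w} : Finset V) ∈ A then 1 else 0)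
      = #{p ∈ S ×ˢ S ×ˢ S | ({p.1, p.2.1, p.2.2} : Finset V) ∈ A} := by
    rw [card_filter, sum_product]
    refine sum_congr rfl fun u _ => ?_
    rw [sum_product]
  rw [h1, card_eq_sum_card_fiberwise (t := A) (f := fun p : V × V × V => ({p.1, p.2.1, p.2.2} : Finset V))]
  · rw [mul_comm, ← smul_eq_mul, ← sum_const]
    refine sum_congr rfl fun t ht => ?_
    obtain ⟨htS, ht3⟩ := mem_powersetCard.1 (hA ht)
    obtain ⟨a, b, c, hab, hac, hbc, rfl⟩ := card_eq_three.1 ht3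
    have haS : a ∈ S := htS (by simp)
    have hbS : b ∈ S := htS (by simp)
    have hcS : c ∈ S := htS (by simp)
    have : ({p ∈ {p ∈ S ×ˢ S ×ˢ S | ({p.1, p.2.1, p.2.2} : Finset V) ∈ A} |
        ({p.1, p.2.1, p.2.2} : Finset V) = {a, b, c}})
        = {(a, b, c), (a, c, b), (b, a, c), (b, c, a), (c, a, b), (c, b, a)} := by
      ext ⟨u, v, w⟩
      simp only [mem_filter, mem_product, mem_insert, mem_singleton, Prod.mk.injEq]
      constructor
      · rintro ⟨-, h⟩
        have ha : a ∈ ({u, v, w} : Finset V) := by rw [h]; simp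
        have hb : b ∈ ({u, v, w} : Finset V) := by rw [h]; simp
        have hc : c ∈ ({u, v, w} : Finset V) := by rw [h]; simp
        simp only [mem_insert, mem_singleton] at ha hb hc
        grind
      · intro h
        have e : ({u, v, w} : Finset V) = {a, b, c} := by
          ext x; simp only [mem_insert, mem_singleton]; grind
        rw [e]
        refine ⟨⟨?_, ht⟩, rfl⟩
        grind
    rw [this]
    repeat rw [card_insert_of_notMem (by simp; grind)]
    simp
  · intro p hp
    simpa using (mem_filter.1 hp).2

open Finset in
theorem sum_rotate {V : Type*} (S : Finset V) (f : V → V → V → V → ℕ) :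
    ∑ z ∈ S, ∑ u ∈ S, ∑ v ∈ S, ∑ w ∈ S, f u v w z
      = ∑ z ∈ S, ∑ u ∈ S, ∑ v ∈ S, ∑ w ∈ S, f z u v w := by
  rw [sum_comm]
  refine sum_congr rfl fun u _ => ?_
  rw [sum_comm]
  refine sum_congr rfl fun v _ => ?_
  rw [sum_comm]

section
variable {V : Type*} [DecidableEq V] (G : SimpleGraph V) [DecidableRel G.Adj]

/-- Triangles inside `S`. -/
def triIn (S : Finset V) : Finset (Finset V) := {t ∈ S.powersetCard 3 | G.IsNClique 3 t}

/-- Closed neighbourhood inside `S`. -/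
def nbIn (S : Finset V) (z : V) : Finset V := {u ∈ S | z = u ∨ G.Adj z u}

/-- Triangles inside `S` that meet the closed neighbourhood of `z`. -/
def triTouch (S : Finset V) (z : V) : Finset (Finset V) :=
  {t ∈ triIn G S | ∃ u ∈ t, z = u ∨ G.Adj z u}

open Finset in
theorem card_eq_three_iff_ne (u v w : V) (h : #({u, v, w} : Finset V) = 3) :
    u ≠ v ∧ u ≠ w ∧ v ≠ w := by
  have h2 : ∀ a b : V, #({a, b} : Finset V) ≤ 2 := fun a b => card_le_two
  refine ⟨?_, ?_, ?_⟩
  · rintro rfl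
    have := h2 u w
    simp at h; omega
  · rintro rfl
    have := h2 v u
    rw [insert_eq_of_mem (by simp)] at h; omega
  · rintro rfl
    have := h2 u v
    simp at h; omega

open Finset in
theorem pointwise (S : Finset V) (z u v w : V) (hz : z ∈ S) (hu : u ∈ S) (hv : v ∈ S) (hw : w ∈ S) :
    ((if ({u, v, w} : Finset V) ∈ triTouch G S z then 1 else 0)
    + (if ({v, w, z} : Finset V) ∈ triTouch G S u then 1 else 0)
    + (if ({w, z, u} : Finset V) ∈ triTouch G S v then 1 else 0)
    + (if ({z, u, v} : Finset V) ∈ triTouch G S w then 1 else 0) : ℕ)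
    ≤ (if ({u, v, w} : Finset V) ∈ (nbIn G S z).powersetCard 3 then 1 else 0)
    + (if ({v, w, z} : Finset V) ∈ (nbIn G S u).powersetCard 3 then 1 else 0)
    + (if ({w, z, u} : Finset V) ∈ (nbIn G S v).powersetCard 3 then 1 else 0)
    + (if ({z, u, v} : Finset V) ∈ (nbIn G S w).powersetCard 3 then 1 else 0) := by
  have hA : ∀ z u v w : V, z ∈ S → u ∈ S → v ∈ S → w ∈ S →
      (({u, v, w} : Finset V) ∈ triTouch G S z ↔ (G.Adj u v ∧ G.Adj u w ∧ G.Adj v w) ∧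
        ((z = u ∨ G.Adj z u) ∨ (z = v ∨ G.Adj z v) ∨ (z = w ∨ G.Adj z w))) := by
    intro z u v w hz hu hv hw
    have h3 : ({u, v, w} : Finset V) ⊆ S := by
      intro x; simp only [mem_insert, mem_singleton]; rintro (rfl | rfl | rfl) <;> assumption
    simp only [triTouch, triIn, mem_filter, mem_powersetCard, SimpleGraph.is3Clique_triple_iff]
    constructor
    · rintro ⟨⟨_, h⟩, x, hx, h'⟩
      refine ⟨h, ?_⟩
      simp only [mem_insert, mem_singleton] at hx
      rcases hx with rfl | rfl | rfl <;> tauto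
    · rintro ⟨h, h'⟩
      refine ⟨⟨⟨h3, card_eq_three.2 ⟨u, v, w, h.1.ne, h.2.1.ne, h.2.2.ne, rfl⟩⟩, h⟩, ?_⟩
      simpa using h'
  have hB : ∀ z u v w : V, z ∈ S → u ∈ S → v ∈ S → w ∈ S →
      (({u, v, w} : Finset V) ∈ (nbIn G S z).powersetCard 3 ↔
        (u ≠ v ∧ u ≠ w ∧ v ≠ w) ∧
          (z = u ∨ G.Adj z u) ∧ (z = v ∨ G.Adj z v) ∧ (z = w ∨ G.Adj z w)) := by
    intro z u v w hz hu hv hw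
    rw [mem_powersetCard]
    constructor
    · rintro ⟨h1, h2⟩
      refine ⟨card_eq_three_iff_ne u v w h2, ?_, ?_, ?_⟩
      · exact (mem_filter.1 (h1 (show u ∈ _ by simp))).2
      · exact (mem_filter.1 (h1 (show v ∈ _ by simp))).2
      · exact (mem_filter.1 (h1 (show w ∈ _ by simp))).2
    · rintro ⟨⟨h1, h2, h3⟩, h4, h5, h6⟩
      refine ⟨?_, card_eq_three.2 ⟨u, v, w, h1, h2, h3, rfl⟩⟩
      intro x; simp only [mem_insert, mem_singleton, nbIn, mem_filter]
      rintro (rfl | rfl | rfl) <;> tauto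
  simp only [hA z u v w hz hu hv hw, hA u v w z hu hv hw hz, hA v w z u hv hw hz hu,
    hA w z u v hw hz hu hv, hB z u v w hz hu hv hw, hB u v w z hu hv hw hz, hB v w z u hv hw hz hu,
    hB w z u v hw hz hu hv]
  clear hA hB hz hu hv hw
  simp only [G.adj_comm u z, G.adj_comm v z, G.adj_comm w z, G.adj_comm v u, G.adj_comm w u,
    G.adj_comm w v, eq_comm (a := u) (b := z), eq_comm (a := v) (b := z), eq_comm (a := w) (b := z),
    eq_comm (a := v) (b := u), eq_comm (a := w) (b := u), eq_comm (a := w) (b := v), ne_eq]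
  have n1 : G.Adj z u → z ≠ u := fun h => h.ne
  have n2 : G.Adj z v → z ≠ v := fun h => h.ne
  have n3 : G.Adj z w → z ≠ w := fun h => h.ne
  have n4 : G.Adj u v → u ≠ v := fun h => h.ne
  have n5 : G.Adj u w → u ≠ w := fun h => h.ne
  have n6 : G.Adj v w → v ≠ w := fun h => h.ne
  have s1 := G.adj_comm u v
  have s2 := G.adj_comm u w
  have s3 := G.adj_comm v w
  have t1 := G.adj_comm z u
  have t2 := G.adj_comm z v
  have t3 := G.adj_comm z w
  by_cases e1 : z = u
  · grind
  by_cases e2 : z = v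
  · grind
  by_cases e3 : z = w
  · grind
  by_cases e4 : u = v
  · grind
  by_cases e5 : u = w
  · grind
  by_cases e6 : v = w
  · grind
  clear n1 n2 n3 n4 n5 n6 s1 s2 s3 t1 t2 t3
  simp only [e1, e2, e3, e4, e5, e6]
  by_cases a1 : G.Adj z u <;> by_cases a2 : G.Adj z v <;> by_cases a3 : G.Adj z w <;>
    by_cases a4 : G.Adj u v <;> by_cases a5 : G.Adj u w <;> by_cases a6 : G.Adj v w <;>
    simp [a1, a2, a3, a4, a5, a6]

open Finset in
theorem sum_touch_le (S : Finset V) :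
    ∑ z ∈ S, #(triTouch G S z) ≤ ∑ z ∈ S, (#(nbIn G S z)).choose 3 := by
  have hA : ∀ z, ∑ u ∈ S, ∑ v ∈ S, ∑ w ∈ S,
      (if ({u, v, w} : Finset V) ∈ triTouch G S z then 1 else 0) = 6 * #(triTouch G S z) :=
    fun z => sum_triples S _ ((filter_subset _ _).trans (filter_subset _ _))
  have hB : ∀ z, ∑ u ∈ S, ∑ v ∈ S, ∑ w ∈ S,
      (if ({u, v, w} : Finset V) ∈ (nbIn G S z).powersetCard 3 then 1 else 0)
        = 6 * (#(nbIn G S z)).choose 3 := fun z => by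
    rw [sum_triples S _ (powersetCard_mono (show nbIn G S z ⊆ S from filter_subset _ _)),
      card_powersetCard]
  have key := sum_le_sum fun z hz => sum_le_sum fun u hu => sum_le_sum fun v hv =>
    sum_le_sum fun w hw => pointwise G S z u v w hz hu hv hw
  simp only [sum_add_distrib] at key
  have rot : ∀ f : V → V → V → V → ℕ,
      (∑ z ∈ S, ∑ u ∈ S, ∑ v ∈ S, ∑ w ∈ S, f u v w z
        = ∑ z ∈ S, ∑ u ∈ S, ∑ v ∈ S, ∑ w ∈ S, f z u v w) ∧
      (∑ z ∈ S, ∑ u ∈ S, ∑ v ∈ S, ∑ w ∈ S, f v w z u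
        = ∑ z ∈ S, ∑ u ∈ S, ∑ v ∈ S, ∑ w ∈ S, f z u v w) ∧
      (∑ z ∈ S, ∑ u ∈ S, ∑ v ∈ S, ∑ w ∈ S, f w z u v
        = ∑ z ∈ S, ∑ u ∈ S, ∑ v ∈ S, ∑ w ∈ S, f z u v w) := by
    intro f
    have r1 := sum_rotate S f
    have r2 := sum_rotate S (fun a b c e => f b c e a)
    have r3 := sum_rotate S (fun a b c e => f c e a b)
    exact ⟨r1, r2.trans r1, r3.trans (r2.trans r1)⟩
  obtain ⟨a1, a2, a3⟩ := rot fun z u v w => if ({u, v, w} : Finset V) ∈ triTouch G S z then 1 else 0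
  obtain ⟨b1, b2, b3⟩ := rot fun z u v w =>
    if ({u, v, w} : Finset V) ∈ (nbIn G S z).powersetCard 3 then 1 else 0
  rw [a1, a2, a3, b1, b2, b3] at key
  simp only [hA, hB, ← mul_sum] at key
  omega

open Finset in
theorem triIn_le (d : ℕ) (S : Finset V) (hdeg : ∀ T ⊆ S, ∀ v ∈ T, #(nbIn G T v) ≤ d + 1) :
    #(triIn G S) ≤ triBound d #S := by
  induction S using Finset.strongInduction with
  | H S ih =>
    rcases S.eq_empty_or_nonempty with rfl | hne
    · have : (∅ : Finset V).powersetCard 3 = ∅ := powersetCard_eq_empty.2 (by simp)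
      simp [triIn, this]
    · obtain ⟨z, hz, hle⟩ := exists_le_of_sum_le hne (sum_touch_le G S)
      have hzn : z ∈ nbIn G S z := by simp [nbIn, hz]
      have hsub : nbIn G S z ⊆ S := filter_subset _ _
      have hss : S \ nbIn G S z ⊂ S := by
        refine ⟨sdiff_subset, fun h => ?_⟩
        exact (mem_sdiff.1 (h hz)).2 hzn
      have h1 := ih _ hss fun T hT => hdeg T (hT.trans hss.1)
      have h2 : triIn G S ⊆ triIn G (S \ nbIn G S z) ∪ triTouch G S z := by
        intro t ht
        rw [mem_union]
        by_cases h : t ∈ triTouch G S z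
        · exact Or.inr h
        · left
          simp only [triTouch, mem_filter, not_and] at h
          have h := h ht
          simp only [triIn, mem_filter, mem_powersetCard] at ht ⊢
          refine ⟨⟨fun x hx => mem_sdiff.2 ⟨ht.1.1 hx, fun hx' => h ⟨x, hx, ?_⟩⟩, ht.1.2⟩, ht.2⟩
          exact (mem_filter.1 hx').2
      have h3 := (card_le_card h2).trans (card_union_le _ _)
      have h4 := triBound_add d #(S \ nbIn G S z) #(nbIn G S z) (hdeg S subset_rfl z hz)
      rw [card_sdiff_add_card_eq_card hsub] at h4
      omega

end

/-- **Gan–Loh–Sudakov conjecture / Theorem 1.**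
Any graph on `n ≥ 1` vertices with maximum degree at most `d ≥ 1` has at most
`q * C(d+1,3) + C(r,3)` triangles, where `n = q*(d+1) + r` with `0 ≤ r ≤ d`. -/
theorem max_triangles_of_max_degree
    (n d q r : ℕ) (hn : 1 ≤ n) (hd : 1 ≤ d)
    (hqr : n = q * (d + 1) + r) (hr : r ≤ d)
    (V : Type*) [Fintype V] [DecidableEq V] (hcard : Fintype.card V = n)
    (G : SimpleGraph V) [DecidableRel G.Adj]
    (hdeg : ∀ v : V, G.degree v ≤ d) :
    (G.cliqueFinset 3).card ≤ q * (d + 1).choose 3 + r.choose 3 := by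
  have h := triIn_le G d Finset.univ (by
    intro T _ v _
    have hs : nbIn G T v ⊆ insert v (G.neighborFinset v) := by
      intro x hx
      have := (Finset.mem_filter.1 hx).2
      simp only [Finset.mem_insert, SimpleGraph.mem_neighborFinset]
      rcases this with h | h
      · exact Or.inl h.symm
      · exact Or.inr h
    have h1 := (Finset.card_le_card hs).trans (Finset.card_insert_le _ _)
    rw [SimpleGraph.card_neighborFinset_eq_degree] at h1
    have := hdeg v
    omega)
  rw [Finset.card_univ, hcard, hqr, triBound_eq d q r hr] at h
  refine (Finset.card_le_card ?_).trans h
  intro t ht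
  rw [SimpleGraph.mem_cliqueFinset_iff] at ht
  simp only [triIn, Finset.mem_filter, Finset.mem_powersetCard]
  exact ⟨⟨Finset.subset_univ _, ht.card_eq⟩, ht⟩
end

section
/- Fix an integer t ≥ 3. For any positive integers n, d ≥ 1, any simple graph on n vertices with maximum degree at most d has at most q·C(d+1,t) + C(r,t) cliques of size t, where n = q(d+1) + r with 0 ≤ r ≤ d. -/
open Finset in
/-- Double counting: pairs (vertex, `t`-set avoiding it) versus pointed `t+1`-sets. -/
theorem aux_double_count {V : Type*} [DecidableEq V] (W : Finset V) (t : ℕ)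
    (P : V → Finset V → Prop) [∀ v K, Decidable (P v K)] :
    ∑ v ∈ W, #{K ∈ powersetCard t W | v ∉ K ∧ P v K}
      = ∑ S ∈ powersetCard (t + 1) W, #{v ∈ S | P v (S.erase v)} := by
  have h1 : ∀ v ∈ W, #{K ∈ powersetCard t W | v ∉ K ∧ P v K}
      = #{S ∈ powersetCard (t + 1) W | v ∈ S ∧ P v (S.erase v)} := by
    intro v hv
    refine Finset.card_bij' (fun K _ => insert v K) (fun S _ => S.erase v) ?_ ?_ ?_ ?_
    · intro K hK
      simp only [mem_filter, mem_powersetCard] at hK ⊢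
      obtain ⟨⟨hKW, hc⟩, hvK, hP⟩ := hK
      refine ⟨⟨insert_subset hv hKW, by rw [card_insert_of_notMem hvK, hc]⟩,
        mem_insert_self _ _, ?_⟩
      rwa [erase_insert hvK]
    · intro S hS
      simp only [mem_filter, mem_powersetCard] at hS ⊢
      obtain ⟨⟨hSW, hc⟩, hvS, hP⟩ := hS
      exact ⟨⟨(erase_subset _ _).trans hSW, by rw [card_erase_of_mem hvS, hc]; rfl⟩,
        notMem_erase _ _, hP⟩
    · intro K hK
      simp only [mem_filter] at hK
      exact erase_insert hK.2.1
    · intro S hS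
      simp only [mem_filter] at hS
      exact insert_erase hS.2.1
  rw [Finset.sum_congr rfl h1]
  have h2 := Finset.sum_card_bipartiteAbove_eq_sum_card_bipartiteBelow
    (s := W) (t := powersetCard (t + 1) W) (fun v S => v ∈ S ∧ P v (S.erase v))
  simp only [bipartiteAbove, bipartiteBelow] at h2
  rw [h2]
  refine Finset.sum_congr rfl fun S hS => ?_
  rw [mem_powersetCard] at hS
  congr 1
  ext v
  simp only [mem_filter]
  exact ⟨fun h => h.2, fun h => ⟨hS.1 h.1, h⟩⟩

open Finset in
/-- Local comparison on a single `t+1`-set. -/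
theorem aux_local {V : Type*} [DecidableEq V] (G : SimpleGraph V) [DecidableRel G.Adj]
    (S : Finset V) (hS : 4 ≤ #S) :
    #{v ∈ S | G.IsClique (S.erase v : Finset V) ∧ ∃ u ∈ S.erase v, G.Adj v u}
      ≤ #{v ∈ S | ∀ u ∈ S.erase v, G.Adj v u} := by
  classical
  set A := {v ∈ S | G.IsClique (S.erase v : Finset V) ∧ ∃ u ∈ S.erase v, G.Adj v u} with hA
  set B := {v ∈ S | ∀ u ∈ S.erase v, G.Adj v u} with hB
  have key : ∀ z ∈ A, ∀ a ∈ S, ∀ b ∈ S, a ≠ z → b ≠ z → a ≠ b → G.Adj a b := by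
    intro z hz a ha b hb haz hbz hab
    simp only [hA, mem_filter] at hz
    exact hz.2.1 (by simp [ha, haz]) (by simp [hb, hbz]) hab
  have hAS : ∀ z ∈ A, z ∈ S := fun z hz => (mem_filter.1 hz).1
  rcases A.eq_empty_or_nonempty with h0 | ⟨z, hz⟩
  · simp [h0]
  by_cases h1 : ∃ z' ∈ A, z' ≠ z
  · obtain ⟨z', hz', hne⟩ := h1
    have hsub : (S.erase z).erase z' ⊆ B := by
      intro w hw
      simp only [mem_erase] at hw
      simp only [hB, mem_filter, mem_erase]
      refine ⟨hw.2.2, fun u hu => ?_⟩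
      by_cases huz : u = z
      · subst huz
        exact key z' hz' w hw.2.2 u hu.2 hw.1 hne.symm hu.1.symm
      · exact key z hz w hw.2.2 u hu.2 hw.2.1 huz hu.1.symm
    have hc : #((S.erase z).erase z') = #S - 1 - 1 := by
      rw [card_erase_of_mem (by simp [hne, hAS z' hz']), card_erase_of_mem (hAS z hz)]
    by_cases hadj : G.Adj z z'
    · have : A ⊆ B := by
        intro w hw
        simp only [hB, mem_filter, mem_erase]
        refine ⟨hAS w hw, fun u hu => ?_⟩
        by_cases hwz : w = z
        · by_cases huz' : u = z'
          · rw [hwz, huz']; exact hadj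
          · exact key z' hz' w (hAS w hw) u hu.2 (by rw [hwz]; exact hne.symm) huz' hu.1.symm
        · by_cases huz : u = z
          · by_cases hwz' : w = z'
            · rw [hwz', huz]; exact hadj.symm
            · exact key z' hz' w (hAS w hw) u hu.2 hwz' (by rw [huz]; exact hne.symm) hu.1.symm
          · exact key z hz w (hAS w hw) u hu.2 hwz huz hu.1.symm
      exact card_le_card this
    · have : A ⊆ {z, z'} := by
        intro w hw
        by_contra hcon
        simp only [mem_insert, mem_singleton, not_or] at hcon
        exact hadj (key w hw z (hAS z hz) z' (hAS z' hz') (Ne.symm hcon.1) (Ne.symm hcon.2)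
          hne.symm)
      have h2 := card_le_card this
      have h3 := card_le_card hsub
      have h4 := Finset.card_le_two (a := z) (b := z')
      omega
  · push Not at h1
    have hA1 : A ⊆ {z} := fun w hw => by simp [h1 w hw]
    have h2 := card_le_card hA1
    rw [card_singleton] at h2
    refine h2.trans (card_pos.2 ?_)
    have hz2 := hz
    simp only [hA, mem_filter, mem_erase] at hz2
    obtain ⟨hzS, -, u, ⟨huz, huS⟩, hzu⟩ := hz2
    refine ⟨u, ?_⟩
    simp only [hB, mem_filter, mem_erase]
    refine ⟨huS, fun w hw => ?_⟩
    by_cases hwz : w = z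
    · rw [hwz]; exact hzu.symm
    · exact key z hz u huS w hw.2 huz hwz hw.1.symm

open Finset in
/-- There is a vertex whose closed neighbourhood meets few cliques. -/
theorem aux_vertex {V : Type*} [DecidableEq V] (G : SimpleGraph V) [DecidableRel G.Adj]
    (W : Finset V) (hW : W.Nonempty) (t : ℕ) (ht : 3 ≤ t) :
    ∃ v ∈ W, #{K ∈ powersetCard t W | G.IsClique (K : Finset V) ∧ (v ∈ K ∨ ∃ u ∈ K, G.Adj v u)}
      ≤ (#{u ∈ W | G.Adj v u} + 1).choose t := by
  classical
  refine Finset.exists_le_of_sum_le hW ?_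
  obtain ⟨s, rfl⟩ : ∃ s, t = s + 1 := ⟨t - 1, by omega⟩
  have hsplit : ∀ v ∈ W,
      #{K ∈ powersetCard (s + 1) W | G.IsClique (K : Finset V) ∧ (v ∈ K ∨ ∃ u ∈ K, G.Adj v u)}
      ≤ (#{u ∈ W | G.Adj v u}).choose s
        + #{K ∈ powersetCard (s + 1) W | v ∉ K ∧ (G.IsClique (K : Finset V) ∧
            ∃ u ∈ K, G.Adj v u)} := by
    intro v hv
    have h1 : #{K ∈ powersetCard (s + 1) W | G.IsClique (K : Finset V) ∧ v ∈ K}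
        ≤ (#{u ∈ W | G.Adj v u}).choose s := by
      rw [← card_powersetCard]
      refine Finset.card_le_card_of_injOn (fun K => K.erase v) ?_ ?_
      · intro K hK
        simp only [coe_filter, Set.mem_ofPred_eq, mem_powersetCard] at hK
        obtain ⟨⟨hKW, hc⟩, hcl, hvK⟩ := hK
        simp only [mem_coe, mem_powersetCard]
        refine ⟨fun u hu => ?_, by rw [card_erase_of_mem hvK, hc]; rfl⟩
        rw [mem_erase] at hu
        rw [mem_filter]
        exact ⟨hKW hu.2, hcl hvK hu.2 hu.1.symm⟩
      · intro K hK L hL h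
        simp only [coe_filter, Set.mem_ofPred_eq] at hK hL
        rw [← insert_erase hK.2.2, ← insert_erase hL.2.2]
        exact congrArg (insert v) h
    refine le_trans ?_ (Nat.add_le_add_right h1 _)
    refine le_trans (card_le_card ?_) (card_union_le _ _)
    intro K hK
    simp only [mem_union, mem_filter] at hK ⊢
    tauto
  refine (sum_le_sum hsplit).trans ?_
  simp only [Nat.choose_succ_succ', sum_add_distrib]
  refine Nat.add_le_add_left ?_ _
  rw [aux_double_count W (s + 1) (fun v K => G.IsClique (K : Finset V) ∧ ∃ u ∈ K, G.Adj v u)]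
  have hstar : ∀ v ∈ W, #{K ∈ powersetCard (s + 1) W | v ∉ K ∧ ∀ u ∈ K, G.Adj v u}
      ≤ (#{u ∈ W | G.Adj v u}).choose (s + 1) := by
    intro v hv
    rw [← card_powersetCard]
    refine card_le_card fun K hK => ?_
    simp only [mem_filter, mem_powersetCard] at hK ⊢
    exact ⟨fun u hu => mem_filter.2 ⟨hK.1.1 hu, hK.2.2 u hu⟩, hK.1.2⟩
  refine le_trans ?_ (sum_le_sum hstar)
  rw [aux_double_count W (s + 1) (fun v K => ∀ u ∈ K, G.Adj v u)]
  refine sum_le_sum fun S hS => ?_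
  rw [mem_powersetCard] at hS
  exact aux_local G S (by omega)

/-- Convexity of binomial coefficients. -/
theorem aux_convex (t a c y : ℕ) (h : c ≤ a) :
    a.choose t + (c + y).choose t ≤ (a + y).choose t + c.choose t := by
  cases t with
  | zero => simp
  | succ s =>
    induction y with
    | zero => simp
    | succ y ih =>
      rw [← add_assoc, ← add_assoc, Nat.choose_succ_succ', Nat.choose_succ_succ' (a + y)]
      have := Nat.choose_le_choose s (Nat.add_le_add_right h y)
      omega

/-- The extremal function is superadditive under adding blocks of size at most `d+1`. -/
theorem aux_arith (t d q r q' r' k : ℕ) (ht : 1 ≤ t) (hr : r ≤ d) (hr' : r' ≤ d) (hk : k ≤ d + 1)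
    (h : q * (d + 1) + r = q' * (d + 1) + r' + k) :
    q' * (d + 1).choose t + r'.choose t + k.choose t ≤ q * (d + 1).choose t + r.choose t := by
  by_cases hlt : r' + k ≤ d
  · have hq : q = q' := by
      have h1 : (q * (d + 1) + r) / (d + 1) = q := by
        rw [mul_comm, Nat.mul_add_div (by omega), Nat.div_eq_of_lt (by omega)]; rfl
      have h2 : (q' * (d + 1) + (r' + k)) / (d + 1) = q' := by
        rw [mul_comm, Nat.mul_add_div (by omega), Nat.div_eq_of_lt (by omega)]; rfl
      rw [← h1, ← h2, h, add_assoc]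
    subst hq
    have hrk : r = r' + k := by omega
    have := aux_convex t r' 0 k (Nat.zero_le _)
    rw [Nat.choose_eq_zero_of_lt (show 0 < t by omega), zero_add] at this
    rw [hrk]; omega
  · obtain ⟨s, hs⟩ : ∃ s, r' + k = d + 1 + s := ⟨r' + k - (d + 1), by omega⟩
    have h' : q * (d + 1) + r = (q' + 1) * (d + 1) + s := by rw [h, add_mul]; omega
    have hq : q = q' + 1 := by
      have h1 : (q * (d + 1) + r) / (d + 1) = q := by
        rw [mul_comm, Nat.mul_add_div (by omega), Nat.div_eq_of_lt (by omega)]; rfl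
      have h2 : ((q' + 1) * (d + 1) + s) / (d + 1) = q' + 1 := by
        rw [mul_comm, Nat.mul_add_div (by omega), Nat.div_eq_of_lt (by omega)]
      rw [← h1, ← h2, h']
    subst hq
    have hrs : r = s := by omega
    have := aux_convex t r' s (k - s) (by omega)
    rw [show s + (k - s) = k by omega, show r' + (k - s) = d + 1 by omega] at this
    rw [hrs, add_mul]; omega

open Finset in
/-- The main induction, on vertex subsets of a fixed graph. -/
theorem aux_main {V : Type*} [DecidableEq V] (G : SimpleGraph V) [DecidableRel G.Adj]
    (t d : ℕ) (ht : 3 ≤ t) (n : ℕ) : ∀ (W : Finset V) (q r : ℕ), #W = n →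
    (∀ v ∈ W, #{u ∈ W | G.Adj v u} ≤ d) → n = q * (d + 1) + r → r ≤ d →
    #{K ∈ powersetCard t W | G.IsClique (K : Finset V)} ≤ q * (d + 1).choose t + r.choose t := by
  classical
  induction n using Nat.strong_induction_on with
  | _ n ih =>
  intro W q r hWn hdeg hqr hr
  rcases W.eq_empty_or_nonempty with rfl | hW
  · rw [powersetCard_eq_empty.2 (by simp; omega)]
    simp
  obtain ⟨v, hv, hcard⟩ := aux_vertex G W hW t ht
  set N := {u ∈ W | G.Adj v u} with hN
  have hvN : v ∉ N := by simp [hN]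
  have hsub : insert v N ⊆ W := insert_subset hv (filter_subset _ _)
  have hins : #(insert v N) = #N + 1 := card_insert_of_notMem hvN
  set W' := W \ insert v N with hW'
  have hW'W : W' ⊆ W := sdiff_subset
  have hc' : #W' + (#N + 1) = n := by
    rw [← hins, ← hWn, hW']; exact card_sdiff_add_card_eq_card hsub
  have hrec := ih #W' (by omega) W' (#W' / (d + 1)) (#W' % (d + 1)) rfl
    (fun w hw => (card_le_card (filter_subset_filter _ hW'W)).trans (hdeg w (hW'W hw)))
    (by rw [mul_comm]; exact (Nat.div_add_mod _ _).symm)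
    (Nat.le_of_lt_succ (Nat.mod_lt _ (by omega)))
  have har := aux_arith t d q r (#W' / (d + 1)) (#W' % (d + 1)) (#N + 1) (by omega) hr
    (Nat.le_of_lt_succ (Nat.mod_lt _ (by omega))) (Nat.succ_le_succ (hdeg v hv))
    (by rw [mul_comm (#W' / (d + 1)), Nat.div_add_mod]; omega)
  refine le_trans ?_ har
  refine le_trans ?_ (Nat.add_le_add hrec hcard)
  refine le_trans (card_le_card ?_) (card_union_le _ _)
  intro K hK
  simp only [mem_union, mem_filter, mem_powersetCard] at hK ⊢
  obtain ⟨⟨hKW, hc⟩, hcl⟩ := hK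
  by_cases hmeet : v ∈ K ∨ ∃ u ∈ K, G.Adj v u
  · exact Or.inr ⟨⟨hKW, hc⟩, hcl, hmeet⟩
  · refine Or.inl ⟨⟨fun x hx => ?_, hc⟩, hcl⟩
    rw [hW', mem_sdiff, mem_insert, hN, mem_filter]
    refine ⟨hKW hx, ?_⟩
    rintro (rfl | h)
    · exact hmeet (Or.inl hx)
    · exact hmeet (Or.inr ⟨x, hx, h.2⟩)

/-- **Theorem 2.** Fix `t ≥ 3`. Any graph on `n ≥ 1` vertices with maximum degree at most
`d ≥ 1` has at most `q * C(d+1,t) + C(r,t)` cliques of size `t`, where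
`n = q*(d+1) + r` with `0 ≤ r ≤ d`. -/
theorem max_cliques_of_max_degree
    (t : ℕ) (ht : 3 ≤ t)
    (n d q r : ℕ) (hn : 1 ≤ n) (hd : 1 ≤ d)
    (hqr : n = q * (d + 1) + r) (hr : r ≤ d)
    (V : Type*) [Fintype V] [DecidableEq V] (hcard : Fintype.card V = n)
    (G : SimpleGraph V) [DecidableRel G.Adj]
    (hdeg : ∀ v : V, G.degree v ≤ d) :
    (G.cliqueFinset t).card ≤ q * (d + 1).choose t + r.choose t := by
  classical
  have h := aux_main G t d ht n Finset.univ q r (by rw [Finset.card_univ, hcard])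
    (fun v _ => by
      have h1 := hdeg v
      rw [← G.card_neighborFinset_eq_degree, G.neighborFinset_eq_filter] at h1
      exact h1) hqr hr
  refine le_trans (Finset.card_le_card fun K hK => ?_) h
  rw [SimpleGraph.mem_cliqueFinset_iff, SimpleGraph.isNClique_iff] at hK
  simp only [Finset.mem_filter, Finset.mem_powersetCard]
  exact ⟨⟨Finset.subset_univ _, hK.2⟩, hK.1⟩
end

section
/- For any finite simple graph G, 6·Σ_v |T_{N[v]}| + |W(G)| = Σ_v d(v)^3, where both sums are over all vertices v of G. -/
open Finset in
lemma aux_six_fiber {V : Type*} [Fintype V] [DecidableEq V]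
    (G : SimpleGraph V) [DecidableRel G.Adj] (p : Finset V → Prop) [DecidablePred p] :
    6 * ((G.cliqueFinset 3).filter p).card =
      ((univ : Finset (V × V × V)).filter (fun q => (G.Adj q.1 q.2.1 ∧ G.Adj q.1 q.2.2 ∧
        G.Adj q.2.1 q.2.2) ∧ p {q.1, q.2.1, q.2.2})).card := by
  classical
  have hmaps : ∀ q ∈ ((univ : Finset (V × V × V)).filter (fun q => (G.Adj q.1 q.2.1 ∧
      G.Adj q.1 q.2.2 ∧ G.Adj q.2.1 q.2.2) ∧ p {q.1, q.2.1, q.2.2})),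
      ({q.1, q.2.1, q.2.2} : Finset V) ∈ (G.cliqueFinset 3).filter p := by
    intro q hq
    simp only [mem_filter, mem_univ, true_and] at hq
    rw [mem_filter, SimpleGraph.mem_cliqueFinset_iff, SimpleGraph.is3Clique_triple_iff]
    exact hq
  rw [Finset.card_eq_sum_card_fiberwise hmaps, Finset.sum_const_nat (m := 6), mul_comm]
  intro t ht
  rw [mem_filter, SimpleGraph.mem_cliqueFinset_iff, SimpleGraph.is3Clique_iff] at ht
  obtain ⟨⟨a, b, c, hab, hac, hbc, rfl⟩, hp⟩ := ht
  have h1 := hab.ne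
  have h2 := hac.ne
  have h3 := hbc.ne
  have hba := hab.symm
  have hca := hac.symm
  have hcb := hbc.symm
  have : (((univ : Finset (V × V × V)).filter (fun q => (G.Adj q.1 q.2.1 ∧
      G.Adj q.1 q.2.2 ∧ G.Adj q.2.1 q.2.2) ∧ p {q.1, q.2.1, q.2.2})).filter
        (fun q => ({q.1, q.2.1, q.2.2} : Finset V) = {a, b, c})) =
      {(a, b, c), (a, c, b), (b, a, c), (b, c, a), (c, a, b), (c, b, a)} := by
    ext ⟨x, y, z⟩
    simp only [mem_filter, mem_univ, true_and, mem_insert, mem_singleton, Prod.mk.injEq]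
    constructor
    · rintro ⟨⟨⟨hxy, hxz, hyz⟩, -⟩, he⟩
      have hx : x ∈ ({a, b, c} : Finset V) := by rw [← he]; simp
      have hy : y ∈ ({a, b, c} : Finset V) := by rw [← he]; simp
      have hz : z ∈ ({a, b, c} : Finset V) := by rw [← he]; simp
      have := hxy.ne
      have := hxz.ne
      have := hyz.ne
      simp only [mem_insert, mem_singleton] at hx hy hz
      grind
    · intro h
      have he : ({x, y, z} : Finset V) = {a, b, c} := by
        ext w
        simp only [mem_insert, mem_singleton]
        grind
      refine ⟨⟨?_, by rw [he]; exact hp⟩, he⟩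
      rcases h with ⟨rfl, rfl, rfl⟩ | ⟨rfl, rfl, rfl⟩ | ⟨rfl, rfl, rfl⟩ | ⟨rfl, rfl, rfl⟩ |
        ⟨rfl, rfl, rfl⟩ | ⟨rfl, rfl, rfl⟩ <;> refine ⟨?_, ?_, ?_⟩ <;> assumption
  rw [this]
  simp [h1, h2, h3, h1.symm, h2.symm, h3.symm]

lemma aux_sum_identity {V : Type*} [Fintype V] (a : V → V → ℤ) (hs : ∀ x y, a x y = a y x) :
    (∑ x, ∑ u, ∑ v, ∑ w, (a u v * a u w * a v w) *
        (1 - (1 - a u x) * (1 - a v x) * (1 - a w x))) +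
      (∑ x, ∑ u, ∑ v, ∑ w, (a u x * a v x * a w x) *
        ((1 - a u v) * (1 - a u w) * (1 - a v w))) =
    ∑ x, ∑ u, ∑ v, ∑ w, a u x * a v x * a w x := by
  have sw1 : ∀ f : V → V → V → V → ℤ,
      ∑ x, ∑ u, ∑ v, ∑ w, f x u v w = ∑ x, ∑ u, ∑ v, ∑ w, f u x v w := fun f =>
    Finset.sum_comm
  have sw2 : ∀ f : V → V → V → V → ℤ,
      ∑ x, ∑ u, ∑ v, ∑ w, f x u v w = ∑ x, ∑ u, ∑ v, ∑ w, f x v u w := fun f =>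
    Finset.sum_congr rfl fun _ _ => Finset.sum_comm
  have sw3 : ∀ f : V → V → V → V → ℤ,
      ∑ x, ∑ u, ∑ v, ∑ w, f x u v w = ∑ x, ∑ u, ∑ v, ∑ w, f x u w v := fun f =>
    Finset.sum_congr rfl fun _ _ => Finset.sum_congr rfl fun _ _ => Finset.sum_comm
  have swv : ∀ f : V → V → V → V → ℤ,
      ∑ x, ∑ u, ∑ v, ∑ w, f x u v w = ∑ x, ∑ u, ∑ v, ∑ w, f v u x w := fun f =>
    (sw1 f).trans ((sw2 _).trans (sw1 _))
  have sww : ∀ f : V → V → V → V → ℤ,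
      ∑ x, ∑ u, ∑ v, ∑ w, f x u v w = ∑ x, ∑ u, ∑ v, ∑ w, f w u v x := fun f =>
    (sw3 f).trans ((swv _).trans (sw3 _))
  -- the parts matched by the transpositions of `x` with `u`, `v`, `w`
  have e1 := sw1 (fun x u v w => a u x * a v x * a w x * (a v w - a u w * a v w))
  have e2 := swv (fun x u v w => a u x * a v x * a w x * (a u w - a u v * a u w))
  have e3 := sww (fun x u v w => a u x * a v x * a w x * (a u v - a u v * a v w))
  have key : ∑ x, ∑ u, ∑ v, ∑ w, ((a u v * a u w * a v w) *
        (1 - (1 - a u x) * (1 - a v x) * (1 - a w x)) +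
      (a u x * a v x * a w x) * ((1 - a u v) * (1 - a u w) * (1 - a v w)) -
      a u x * a v x * a w x) =
      ∑ x, ∑ u, ∑ v, ∑ w, (
        (a x u * a v u * a w u * (a v w - a x w * a v w)
          - a u x * a v x * a w x * (a v w - a u w * a v w)) +
        (a u v * a x v * a w v * (a u w - a u x * a u w)
          - a u x * a v x * a w x * (a u w - a u v * a u w)) +
        (a u w * a v w * a x w * (a u v - a u v * a v x)
          - a u x * a v x * a w x * (a u v - a u v * a v w))) := by
    refine Finset.sum_congr rfl fun x _ => Finset.sum_congr rfl fun u _ =>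
      Finset.sum_congr rfl fun v _ => Finset.sum_congr rfl fun w _ => ?_
    rw [hs x u, hs x v, hs x w, hs v u, hs w u, hs w v]
    ring
  simp only [Finset.sum_add_distrib, Finset.sum_sub_distrib] at key e1 e2 e3 ⊢
  linarith

/-- **Lemma 2.** For any finite graph `G`, `6 * Σ_v |T_{N[v]}| + |W(G)| = Σ_v d(v)^3`,
where `|T_{N[v]}|` is the number of triangles with a vertex in the closed neighborhood of `v`
and `W(G)` is the set of 4-tuples `(x,u,v,w)` with `ux, vx, wx` edges and `uv, uw, vw` nonedges. -/
theorem six_sum_triangles_add_W_eq_sum_degree_cubed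
    (V : Type*) [Fintype V] [DecidableEq V]
    (G : SimpleGraph V) [DecidableRel G.Adj] :
    6 * (∑ v : V,
        ((G.cliqueFinset 3).filter (fun t => ∃ u ∈ t, u = v ∨ G.Adj u v)).card)
      + ((Finset.univ : Finset (V × V × V × V)).filter
          (fun p => G.Adj p.2.1 p.1 ∧ G.Adj p.2.2.1 p.1 ∧ G.Adj p.2.2.2 p.1 ∧
            ¬ G.Adj p.2.1 p.2.2.1 ∧ ¬ G.Adj p.2.1 p.2.2.2 ∧ ¬ G.Adj p.2.2.1 p.2.2.2)).card
      = ∑ v : V, (G.degree v) ^ 3 := by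
  classical
  let a : V → V → ℤ := fun x y => if G.Adj x y then 1 else 0
  have hs : ∀ x y, a x y = a y x := fun x y => by simp only [a, G.adj_comm]
  have hmain := aux_sum_identity a hs
  have hT : ∀ x : V, ((6 * ((G.cliqueFinset 3).filter
      (fun t => ∃ u ∈ t, u = x ∨ G.Adj u x)).card : ℕ) : ℤ) =
      ∑ u, ∑ v, ∑ w, (a u v * a u w * a v w) *
        (1 - (1 - a u x) * (1 - a v x) * (1 - a w x)) := by
    intro x
    rw [aux_six_fiber, Finset.card_filter]
    push_cast
    rw [Fintype.sum_prod_type]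
    refine Finset.sum_congr rfl fun u _ => ?_
    rw [Fintype.sum_prod_type]
    refine Finset.sum_congr rfl fun v _ => Finset.sum_congr rfl fun w _ => ?_
    simp only [a, Finset.mem_insert, Finset.mem_singleton, exists_eq_or_imp, exists_eq_left]
    by_cases h : G.Adj u v ∧ G.Adj u w ∧ G.Adj v w
    · obtain ⟨h1, h2, h3⟩ := h
      have hiff : ((u = x ∨ G.Adj u x) ∨ (v = x ∨ G.Adj v x) ∨ (w = x ∨ G.Adj w x)) ↔
          (G.Adj u x ∨ G.Adj v x ∨ G.Adj w x) := by
        constructor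
        · rintro ((rfl | h) | (rfl | h) | (rfl | h))
          · exact Or.inr (Or.inl h1.symm)
          · exact Or.inl h
          · exact Or.inl h1
          · exact Or.inr (Or.inl h)
          · exact Or.inl h2
          · exact Or.inr (Or.inr h)
        · tauto
      simp only [hiff, h1, h2, h3]
      by_cases k1 : G.Adj u x <;> by_cases k2 : G.Adj v x <;> by_cases k3 : G.Adj w x <;>
        simp [k1, k2, k3]
    · rw [if_neg (fun hh => h hh.1)]
      by_cases k1 : G.Adj u v <;> by_cases k2 : G.Adj u w <;> by_cases k3 : G.Adj v w <;>
        simp_all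
  have hW : ((((Finset.univ : Finset (V × V × V × V)).filter
          (fun p => G.Adj p.2.1 p.1 ∧ G.Adj p.2.2.1 p.1 ∧ G.Adj p.2.2.2 p.1 ∧
            ¬ G.Adj p.2.1 p.2.2.1 ∧ ¬ G.Adj p.2.1 p.2.2.2 ∧ ¬ G.Adj p.2.2.1 p.2.2.2)).card : ℕ)
          : ℤ) = ∑ x, ∑ u, ∑ v, ∑ w, (a u x * a v x * a w x) *
        ((1 - a u v) * (1 - a u w) * (1 - a v w)) := by
    rw [Finset.card_filter]
    push_cast
    rw [Fintype.sum_prod_type]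
    refine Finset.sum_congr rfl fun x _ => ?_
    rw [Fintype.sum_prod_type]
    refine Finset.sum_congr rfl fun u _ => ?_
    rw [Fintype.sum_prod_type]
    refine Finset.sum_congr rfl fun v _ => Finset.sum_congr rfl fun w _ => ?_
    simp only [a]
    by_cases k1 : G.Adj u x <;> by_cases k2 : G.Adj v x <;> by_cases k3 : G.Adj w x <;>
      by_cases k4 : G.Adj u v <;> by_cases k5 : G.Adj u w <;> by_cases k6 : G.Adj v w <;>
        simp [k1, k2, k3, k4, k5, k6]
  have hD : ∀ x : V, (((G.degree x) ^ 3 : ℕ) : ℤ) = ∑ u, ∑ v, ∑ w, a u x * a v x * a w x := by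
    intro x
    have hd : ((G.degree x : ℕ) : ℤ) = ∑ u, a u x := by
      simp only [a]
      rw [← G.card_neighborFinset_eq_degree, G.neighborFinset_eq_filter, Finset.card_filter]
      push_cast
      simp only [G.adj_comm]
    push_cast
    rw [hd, pow_three']
    simp only [← Finset.mul_sum, ← Finset.sum_mul]
  zify
  rw [Finset.mul_sum]
  push_cast at hT hW hD
  rw [Finset.sum_congr rfl (fun x _ => hT x), Finset.sum_congr rfl (fun x _ => hD x), hW]
  exact hmain
end

section
/- For any simple graph G on n vertices, |T(G)| + |T(G^c)| = C(n,3) − (1/2)·Σ_v d(v)·(n − 1 − d(v)), where the sum is over all vertices v of G; equivalently, 2|T(G)| + 2|T(G^c)| = 2·C(n,3) − Σ_v d(v)·(n − 1 − d(v)). -/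
lemma fiber_card_aux {V : Type*} [Fintype V] [DecidableEq V]
    (G : SimpleGraph V) [DecidableRel G.Adj] (s : Finset V) (hs : s.card = 3) :
    (((Finset.univ : Finset V).sigma
      (fun v => G.neighborFinset v ×ˢ Gᶜ.neighborFinset v)).filter
        (fun t => ({t.1, t.2.1, t.2.2} : Finset V) = s)).card
      + 2 * (if G.IsNClique 3 s then 1 else 0) + 2 * (if Gᶜ.IsNClique 3 s then 1 else 0) = 2 := by
  obtain ⟨x, y, z, hxy, hxz, hyz, rfl⟩ := Finset.card_eq_three.mp hs
  have key : (((Finset.univ : Finset V).sigma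
      (fun v => G.neighborFinset v ×ˢ Gᶜ.neighborFinset v)).filter
        (fun t => ({t.1, t.2.1, t.2.2} : Finset V) = {x, y, z})) =
      ({⟨x, y, z⟩, ⟨x, z, y⟩, ⟨y, x, z⟩, ⟨y, z, x⟩, ⟨z, x, y⟩, ⟨z, y, x⟩} :
        Finset (Σ _ : V, V × V)).filter (fun t => G.Adj t.1 t.2.1 ∧ ¬ G.Adj t.1 t.2.2) := by
    ext ⟨a, b, c⟩
    simp only [Finset.mem_filter, Finset.mem_sigma, Finset.mem_univ, true_and,
      Finset.mem_product, SimpleGraph.mem_neighborFinset, SimpleGraph.compl_adj,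
      Finset.mem_insert, Finset.mem_singleton, Sigma.mk.injEq, heq_eq_eq, Prod.mk.injEq]
    constructor
    · rintro ⟨⟨h1, h2, h3⟩, h⟩
      have hab := h1.ne
      have hbc : b ≠ c := by rintro rfl; exact h3 h1
      have ha : a ∈ ({x, y, z} : Finset V) := by rw [← h]; simp
      have hb : b ∈ ({x, y, z} : Finset V) := by rw [← h]; simp
      have hc : c ∈ ({x, y, z} : Finset V) := by rw [← h]; simp
      simp only [Finset.mem_insert, Finset.mem_singleton] at ha hb hc
      refine ⟨?_, h1, h3⟩
      clear h
      grind
    · rintro ⟨h, h1, h3⟩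
      refine ⟨⟨h1, ?_, h3⟩, ?_⟩
      · grind
      · ext w
        simp only [Finset.mem_insert, Finset.mem_singleton]
        grind
  rw [key]
  simp only [SimpleGraph.is3Clique_triple_iff, SimpleGraph.compl_adj]
  have e1 := G.adj_comm y x
  have e2 := G.adj_comm z x
  have e3 := G.adj_comm z y
  by_cases h1 : G.Adj x y <;> by_cases h2 : G.Adj x z <;> by_cases h3 : G.Adj y z <;>
    simp [Finset.filter_insert, Finset.filter_singleton, e1, e2, e3, h1, h2, h3, hxy, hxz, hyz,
      hxy.symm, hxz.symm, hyz.symm]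

/-- The relation between the number of triangles in a graph and in its complement:
`|T(G)| + |T(Gᶜ)| = C(n,3) - (1/2) Σ_v d(v)(n - 1 - d(v))`. -/
theorem triangles_add_compl_triangles
    (n : ℕ) (V : Type*) [Fintype V] [DecidableEq V] (hcard : Fintype.card V = n)
    (G : SimpleGraph V) [DecidableRel G.Adj] :
    ((G.cliqueFinset 3).card : ℚ) + ((Gᶜ.cliqueFinset 3).card : ℚ)
      = (n.choose 3 : ℚ)
        - (1 / 2) * ∑ v : V, (G.degree v : ℚ) * ((n : ℚ) - 1 - (G.degree v : ℚ)) := by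
  have hT : ∀ (H : SimpleGraph V) [DecidableRel H.Adj], (H.cliqueFinset 3).card =
      ∑ s ∈ Finset.powersetCard 3 (Finset.univ : Finset V),
        (if H.IsNClique 3 s then 1 else 0) := by
    intro H _
    rw [← Finset.card_filter]
    congr 1
    ext s
    simp only [SimpleGraph.mem_cliqueFinset_iff, Finset.mem_filter, Finset.mem_powersetCard_univ]
    exact ⟨fun h => ⟨h.card_eq, h⟩, fun h => h.2⟩
  have hP := Finset.card_eq_sum_card_fiberwise
    (s := (Finset.univ : Finset V).sigma
      (fun v => G.neighborFinset v ×ˢ Gᶜ.neighborFinset v))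
    (t := Finset.powersetCard 3 (Finset.univ : Finset V))
    (f := fun t => ({t.1, t.2.1, t.2.2} : Finset V)) (by
      rintro ⟨a, b, c⟩ h
      simp only [Finset.mem_coe, Finset.mem_sigma, Finset.mem_univ, true_and,
        Finset.mem_product, SimpleGraph.mem_neighborFinset, SimpleGraph.compl_adj,
        Finset.mem_powersetCard_univ] at h ⊢
      obtain ⟨h1, h2, h3⟩ := h
      exact Finset.card_eq_three.mpr ⟨a, b, c, h1.ne, h2, by rintro rfl; exact h3 h1, rfl⟩)
  have hsum := Finset.sum_congr (rfl : Finset.powersetCard 3 (Finset.univ : Finset V) = _)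
    (fun s hs => fiber_card_aux G s (Finset.mem_powersetCard_univ.mp hs))
  rw [Finset.sum_add_distrib, Finset.sum_add_distrib, ← Finset.mul_sum, ← Finset.mul_sum,
    ← hT, ← hT, ← hP, Finset.sum_const, Finset.card_powersetCard, Finset.card_univ, hcard,
    Finset.card_sigma] at hsum
  simp only [Finset.card_product, SimpleGraph.card_neighborFinset_eq_degree, smul_eq_mul] at hsum
  have hd : ∑ v : V, (G.degree v : ℚ) * ((n : ℚ) - 1 - (G.degree v : ℚ))
      = ∑ v : V, (G.degree v : ℚ) * (Gᶜ.degree v : ℚ) := by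
    refine Finset.sum_congr rfl fun v _ => ?_
    have h1 := G.degree_compl v
    have h2 := G.degree_lt_card_verts v
    have h3 : Gᶜ.degree v + G.degree v + 1 = n := by omega
    rw [← h3]; push_cast; ring
  rw [hd]
  have hq := congrArg (Nat.cast : ℕ → ℚ) hsum
  push_cast at hq
  linarith
end

section
/- Let n, d ≥ 1 be positive integers and write n = q(d+1) + r with 0 ≤ r ≤ d. If r ≥ 3, then any simple graph on n vertices with maximum degree at most d that has exactly q·C(d+1,3) + C(r,3) triangles is isomorphic to the disjoint union of q copies of the complete graph K_{d+1} and one copy of K_r. -/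
namespace ExtremalAux

/-- The number of ordered triples of distinct elements of an `m`-set. -/
def g (m : ℕ) : ℤ := m * (m - 1) * (m - 2)

/-- Six times the extremal number of triangles. -/
def f (d n : ℕ) : ℤ := (n / (d + 1) : ℕ) * g (d + 1) + g (n % (d + 1))

lemma f_eq (d q r : ℕ) (hr : r ≤ d) : f d (q * (d + 1) + r) = q * g (d + 1) + g r := by
  have h1 : (q * (d + 1) + r) / (d + 1) = q := by
    rw [mul_comm, Nat.mul_add_div (by omega), Nat.div_eq_of_lt (by omega), add_zero]
  have h2 : (q * (d + 1) + r) % (d + 1) = r := by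
    rw [mul_comm, Nat.mul_add_mod, Nat.mod_eq_of_lt (by omega)]
  rw [f, h1, h2]

lemma arith (d q r b : ℕ) (hr : r ≤ d) (hb : 1 ≤ b) (hbd : b ≤ d + 1) (hn : b ≤ q * (d + 1) + r) :
    g b + f d (q * (d + 1) + r - b) ≤ q * g (d + 1) + g r ∧
    (3 ≤ r → b ≠ d + 1 → b ≠ r → g b + f d (q * (d + 1) + r - b) < q * g (d + 1) + g r) := by
  rcases le_or_gt b r with h | h
  · obtain ⟨c, rfl⟩ := Nat.exists_eq_add_of_le h
    have : q * (d + 1) + (b + c) - b = q * (d + 1) + c := by omega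
    rw [this, f_eq d q c (by omega)]
    have key : g (b + c) - g b - g c = 3 * ((b : ℤ) * c * (b + c - 2)) := by
      simp only [g]; push_cast; ring
    constructor
    · rcases Nat.eq_zero_or_pos c with rfl | hc
      · simp only [Nat.cast_zero, mul_zero, zero_mul, add_zero] at key ⊢; linarith
      · have : (0 : ℤ) ≤ (b : ℤ) * c * (b + c - 2) := by
          apply mul_nonneg (by positivity); omega
        linarith
    · intro h3 _ hne
      have : (0 : ℤ) < (b : ℤ) * c * (b + c - 2) := by
        apply mul_pos
        · apply mul_pos <;> omega
        · omega
      linarith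
  · obtain ⟨x, rfl⟩ := Nat.exists_eq_add_of_le h.le
    obtain ⟨y, hy⟩ := Nat.exists_eq_add_of_le hbd
    have hq : 1 ≤ q := by
      rcases Nat.eq_zero_or_pos q with rfl | h
      · omega
      · exact h
    obtain ⟨k, rfl⟩ := Nat.exists_eq_add_of_le' hq
    have : (k + 1) * (d + 1) + r - (r + x) = k * (d + 1) + (r + y) := by
      rw [add_mul]; omega
    rw [this, f_eq d k (r + y) (by omega), hy]
    have key : g (r + x + y) + g r - g (r + x) - g (r + y)
        = 3 * ((x : ℤ) * y * (2 * r + x + y - 2)) := by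
      simp only [g]; push_cast; ring
    push_cast
    constructor
    · rcases Nat.eq_zero_or_pos y with rfl | hc
      · simp at key ⊢; linarith
      · have : (0 : ℤ) ≤ (x : ℤ) * y * (2 * r + x + y - 2) := by
          apply mul_nonneg (by positivity); omega
        linarith
    · intro h3 hne _
      have : (0 : ℤ) < (x : ℤ) * y * (2 * r + x + y - 2) := by
        apply mul_pos
        · apply mul_pos <;> omega
        · omega
      linarith

section graph
variable {V : Type*} [DecidableEq V] (G : SimpleGraph V) [DecidableRel G.Adj]

/-- Closed adjacency. -/
abbrev R (v x : V) : Prop := v = x ∨ G.Adj v x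

/-- `u, v, w` is an ordered triangle. -/
abbrev T3 (u v w : V) : Prop := G.Adj u v ∧ G.Adj u w ∧ G.Adj v w

/-- Indicator of a triangle meeting the closed neighbourhood of `z`. -/
def om (z u v w : V) : ℤ := if T3 G u v w ∧ (R G z u ∨ R G z v ∨ R G z w) then 1 else 0

/-- Indicator of a triple of distinct elements in the closed neighbourhood of `z`. -/
def sg (z u v w : V) : ℤ :=
  if (u ≠ v ∧ u ≠ w ∧ v ≠ w) ∧ (R G z u ∧ R G z v ∧ R G z w) then 1 else 0

/-- Number of ordered triangles inside `S`. -/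
def tri (S : Finset V) : ℤ := ∑ u ∈ S, ∑ v ∈ S, ∑ w ∈ S, if T3 G u v w then 1 else 0

/-- Closed neighbourhood inside `S`. -/
def nb (S : Finset V) (z : V) : Finset V := S.filter (R G z)

lemma pointwise (z u v w : V) :
    om G z u v w + om G u z v w + om G v u z w + om G w u v z ≤
    sg G z u v w + sg G u z v w + sg G v u z w + sg G w u v z := by
  have s1 := G.adj_comm z u
  have s2 := G.adj_comm z v
  have s3 := G.adj_comm z w
  have s4 := G.adj_comm u v
  have s5 := G.adj_comm u w
  have s6 := G.adj_comm v w
  have l1 := G.loopless.irrefl z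
  have l2 := G.loopless.irrefl u
  have l3 := G.loopless.irrefl v
  have l4 := G.loopless.irrefl w
  unfold om sg T3 R
  by_cases e1 : z = u
  · subst e1; simp only [l1]; grind
  by_cases e2 : z = v
  · subst e2; simp only [l1]; grind
  by_cases e3 : z = w
  · subst e3; simp only [l1]; grind
  by_cases e4 : u = v
  · subst e4; grind
  by_cases e5 : u = w
  · subst e5; grind
  by_cases e6 : v = w
  · subst e6; grind
  by_cases a1 : G.Adj z u <;> by_cases a2 : G.Adj z v <;> by_cases a3 : G.Adj z w <;>
  by_cases a4 : G.Adj u v <;> by_cases a5 : G.Adj u w <;> by_cases a6 : G.Adj v w <;>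
  simp_all [eq_comm]

lemma pointwise_strict (a b c : V) (hab : G.Adj a b) (hac : G.Adj a c) (hne : b ≠ c)
    (hbc : ¬ G.Adj b c) :
    om G a a b c + om G a a b c + om G b a a c + om G c a b a <
    sg G a a b c + sg G a a b c + sg G b a a c + sg G c a b a := by
  have := hab.ne
  have := hac.ne
  simp [om, sg, T3, R, *]

lemma symm4 (S : Finset V) (F : V → V → V → V → ℤ) :
    ∑ z ∈ S, ∑ u ∈ S, ∑ v ∈ S, ∑ w ∈ S, (F z u v w + F u z v w + F v u z w + F w u v z) =
    4 * ∑ z ∈ S, ∑ u ∈ S, ∑ v ∈ S, ∑ w ∈ S, F z u v w := by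
  simp only [Finset.sum_add_distrib]
  have h1 : ∑ z ∈ S, ∑ u ∈ S, ∑ v ∈ S, ∑ w ∈ S, F u z v w =
      ∑ z ∈ S, ∑ u ∈ S, ∑ v ∈ S, ∑ w ∈ S, F z u v w := Finset.sum_comm
  have h2 : ∑ z ∈ S, ∑ u ∈ S, ∑ v ∈ S, ∑ w ∈ S, F v u z w =
      ∑ z ∈ S, ∑ u ∈ S, ∑ v ∈ S, ∑ w ∈ S, F z u v w := by
    rw [Finset.sum_comm]
    conv_rhs => rw [Finset.sum_comm]
    exact Finset.sum_congr rfl fun u _ => Finset.sum_comm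
  have h3 : ∑ z ∈ S, ∑ u ∈ S, ∑ v ∈ S, ∑ w ∈ S, F w u v z =
      ∑ z ∈ S, ∑ u ∈ S, ∑ v ∈ S, ∑ w ∈ S, F z u v w := by
    rw [Finset.sum_comm]
    conv_rhs => rw [Finset.sum_comm]
    refine Finset.sum_congr rfl fun u _ => ?_
    rw [Finset.sum_comm]
    conv_rhs => rw [Finset.sum_comm]
    exact Finset.sum_congr rfl fun u _ => Finset.sum_comm
  rw [h1, h2, h3]; ring

lemma sum_le (S : Finset V) :
    ∑ z ∈ S, ∑ u ∈ S, ∑ v ∈ S, ∑ w ∈ S, om G z u v w ≤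
    ∑ z ∈ S, ∑ u ∈ S, ∑ v ∈ S, ∑ w ∈ S, sg G z u v w := by
  have h1 := symm4 S (om G)
  have h2 := symm4 S (sg G)
  have : ∑ z ∈ S, ∑ u ∈ S, ∑ v ∈ S, ∑ w ∈ S,
      (om G z u v w + om G u z v w + om G v u z w + om G w u v z) ≤
      ∑ z ∈ S, ∑ u ∈ S, ∑ v ∈ S, ∑ w ∈ S,
      (sg G z u v w + sg G u z v w + sg G v u z w + sg G w u v z) :=
    Finset.sum_le_sum fun z _ => Finset.sum_le_sum fun u _ => Finset.sum_le_sum fun v _ =>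
      Finset.sum_le_sum fun w _ => pointwise G z u v w
  linarith

lemma sum_lt (S : Finset V) (a b c : V) (ha : a ∈ S) (hb : b ∈ S) (hc : c ∈ S)
    (hab : G.Adj a b) (hac : G.Adj a c) (hne : b ≠ c) (hbc : ¬ G.Adj b c) :
    ∑ z ∈ S, ∑ u ∈ S, ∑ v ∈ S, ∑ w ∈ S, om G z u v w <
    ∑ z ∈ S, ∑ u ∈ S, ∑ v ∈ S, ∑ w ∈ S, sg G z u v w := by
  have h1 := symm4 S (om G)
  have h2 := symm4 S (sg G)
  have : ∑ z ∈ S, ∑ u ∈ S, ∑ v ∈ S, ∑ w ∈ S,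
      (om G z u v w + om G u z v w + om G v u z w + om G w u v z) <
      ∑ z ∈ S, ∑ u ∈ S, ∑ v ∈ S, ∑ w ∈ S,
      (sg G z u v w + sg G u z v w + sg G v u z w + sg G w u v z) := by
    refine Finset.sum_lt_sum (fun z _ => Finset.sum_le_sum fun u _ => Finset.sum_le_sum fun v _ =>
      Finset.sum_le_sum fun w _ => pointwise G z u v w) ⟨a, ha, ?_⟩
    refine Finset.sum_lt_sum (fun u _ => Finset.sum_le_sum fun v _ =>
      Finset.sum_le_sum fun w _ => pointwise G a u v w) ⟨a, ha, ?_⟩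
    refine Finset.sum_lt_sum (fun v _ =>
      Finset.sum_le_sum fun w _ => pointwise G a a v w) ⟨b, hb, ?_⟩
    exact Finset.sum_lt_sum (fun w _ => pointwise G a a b w)
      ⟨c, hc, pointwise_strict G a b c hab hac hne hbc⟩
  linarith

lemma count2 (A : Finset V) (x : V) (hx : x ∈ A) :
    ∑ y ∈ A, (if x ≠ y then (1 : ℤ) else 0) = A.card - 1 := by
  rw [← Finset.sum_filter, Finset.filter_ne, Finset.sum_const, Finset.card_erase_of_mem hx]
  have : 1 ≤ A.card := Finset.card_pos.2 ⟨x, hx⟩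
  simp; omega

lemma count3 (A : Finset V) :
    ∑ x ∈ A, ∑ y ∈ A, ∑ z ∈ A, (if x ≠ y ∧ x ≠ z ∧ y ≠ z then (1 : ℤ) else 0) = g A.card := by
  have h : ∀ x ∈ A, ∀ y ∈ A,
      ∑ z ∈ A, (if x ≠ y ∧ x ≠ z ∧ y ≠ z then (1 : ℤ) else 0) =
      (if x ≠ y then (1 : ℤ) else 0) * (A.card - 2) := by
    intro x hx y hy
    by_cases hxy : x = y
    · simp [hxy]
    · have : (A.erase x).card = A.card - 1 := Finset.card_erase_of_mem hx
      have h1 : 1 ≤ A.card := Finset.card_pos.2 ⟨x, hx⟩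
      have hy' : y ∈ A.erase x := Finset.mem_erase.2 ⟨Ne.symm hxy, hy⟩
      have := count2 (A.erase x) y hy'
      rw [← Finset.filter_ne, Finset.sum_filter, Finset.filter_ne] at this
      have e : ∀ z, (if x ≠ y ∧ x ≠ z ∧ y ≠ z then (1 : ℤ) else 0)
        = if x ≠ z then (if y ≠ z then 1 else 0) else 0 := by
        intro z; split_ifs <;> simp_all
      rw [Finset.sum_congr rfl fun z _ => e z, this]
      simp only [ne_eq, hxy, not_false_eq_true, if_true, one_mul]
      omega
  rw [Finset.sum_congr rfl fun x hx => Finset.sum_congr rfl fun y hy => h x hx y hy]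
  simp only [← Finset.sum_mul]
  rw [Finset.sum_congr rfl fun x hx => count2 A x hx]
  simp only [Finset.sum_const, nsmul_eq_mul, g]

lemma sg_sum (S : Finset V) (z : V) :
    ∑ u ∈ S, ∑ v ∈ S, ∑ w ∈ S, sg G z u v w = g (nb G S z).card := by
  rw [← count3, nb, Finset.sum_filter]
  refine Finset.sum_congr rfl fun u _ => ?_
  split_ifs with h1
  · rw [Finset.sum_filter]
    refine Finset.sum_congr rfl fun v _ => ?_
    split_ifs with h2
    · rw [Finset.sum_filter]
      refine Finset.sum_congr rfl fun w _ => ?_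
      unfold sg
      split_ifs <;> simp_all
    · exact Finset.sum_eq_zero fun w _ => by simp [sg, h2]
  · exact Finset.sum_eq_zero fun v _ => Finset.sum_eq_zero fun w _ => by simp [sg, h1]

lemma om_sum (S : Finset V) (z : V) :
    tri G S = tri G (S \ nb G S z) + ∑ u ∈ S, ∑ v ∈ S, ∑ w ∈ S, om G z u v w := by
  have e : S \ nb G S z = S.filter (fun x => ¬ R G z x) := by
    ext x; simp [nb]; tauto
  rw [e]
  have : tri G (S.filter (fun x => ¬ R G z x)) = ∑ u ∈ S, ∑ v ∈ S, ∑ w ∈ S,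
      if T3 G u v w ∧ ¬ (R G z u ∨ R G z v ∨ R G z w) then 1 else 0 := by
    rw [tri, Finset.sum_filter]
    refine Finset.sum_congr rfl fun u _ => ?_
    by_cases h1 : R G z u
    on_goal 2 =>
      rw [if_pos h1, Finset.sum_filter]
      refine Finset.sum_congr rfl fun v _ => ?_
      by_cases h2 : R G z v
      on_goal 2 =>
        rw [if_pos h2, Finset.sum_filter]
        refine Finset.sum_congr rfl fun w _ => ?_
        by_cases h3 : R G z w
        · rw [if_neg (by tauto), if_neg (by tauto)]
        · rw [if_pos h3]
          exact if_congr (by tauto) rfl rfl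
      · rw [if_neg (by tauto)]
        exact (Finset.sum_eq_zero fun w _ => if_neg (by tauto)).symm
    · rw [if_neg (by tauto)]
      exact (Finset.sum_eq_zero fun v _ => Finset.sum_eq_zero fun w _ => if_neg (by tauto)).symm
  rw [this, tri]
  simp only [← Finset.sum_add_distrib]
  refine Finset.sum_congr rfl fun u _ => Finset.sum_congr rfl fun v _ =>
    Finset.sum_congr rfl fun w _ => ?_
  unfold om
  by_cases h : T3 G u v w <;> by_cases h' : (R G z u ∨ R G z v ∨ R G z w) <;> simp [h, h']

lemma nb_sub (S : Finset V) (z : V) : nb G S z ⊆ S := Finset.filter_subset _ _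

lemma nb_pos (S : Finset V) (z : V) (hz : z ∈ S) : 1 ≤ (nb G S z).card :=
  Finset.card_pos.2 ⟨z, by simp [nb, R, hz]⟩

lemma step (d : ℕ) (S : Finset V) (b : ℕ) (hb : 1 ≤ b) (hbd : b ≤ d + 1) (hn : b ≤ S.card) :
    g b + f d (S.card - b) ≤ f d S.card := by
  have h1 : S.card = S.card / (d + 1) * (d + 1) + S.card % (d + 1) := by
    rw [mul_comm]; exact (Nat.div_add_mod _ _).symm
  have h2 : S.card % (d + 1) ≤ d := Nat.lt_succ_iff.1 (Nat.mod_lt _ (by omega))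
  have := (arith d _ _ b h2 hb hbd (h1 ▸ hn)).1
  rw [← h1] at this
  exact this

lemma upper (d : ℕ) (hd : ∀ S z, (nb G S z).card ≤ d + 1) :
    ∀ k (S : Finset V), S.card = k → tri G S ≤ f d S.card := by
  intro k
  induction k using Nat.strong_induction_on with
  | _ k ih =>
  intro S hS
  rcases S.eq_empty_or_nonempty with rfl | hne
  · simp [tri, f, g]
  · obtain ⟨z, hz, hle⟩ := Finset.exists_le_of_sum_le hne (sum_le G S)
    rw [sg_sum] at hle
    have h1 := om_sum G S z
    have hp := nb_pos G S z hz
    have hc : (S \ nb G S z).card = S.card - (nb G S z).card :=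
      Finset.card_sdiff_of_subset (nb_sub G S z)
    have hcl := Finset.card_le_card (nb_sub G S z)
    have h2 := ih _ (by omega) (S \ nb G S z) rfl
    rw [hc] at h2
    have h3 := step d S _ hp (hd S z) hcl
    linarith

lemma structure_lemma [Fintype V] (d : ℕ) (hd : ∀ S z, (nb G S z).card ≤ d + 1)
    (ht : tri G Finset.univ = f d (Fintype.card V)) :
    (∀ a b c, G.Adj a b → G.Adj a c → b ≠ c → G.Adj b c) ∧
    ∀ z, g (nb G Finset.univ z).card + f d (Fintype.card V - (nb G Finset.univ z).card)
      = f d (Fintype.card V) := by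
  have key : ∀ z, f d (Fintype.card V) - f d (Fintype.card V - (nb G Finset.univ z).card) ≤
      ∑ u, ∑ v, ∑ w, om G z u v w := by
    intro z
    have h1 := om_sum G Finset.univ z
    have hc : (Finset.univ \ nb G Finset.univ z).card = Fintype.card V - (nb G Finset.univ z).card :=
      Finset.card_sdiff_of_subset (nb_sub G _ z)
    have h2 := upper G d hd _ (Finset.univ \ nb G Finset.univ z) rfl
    rw [hc] at h2
    linarith
  have key2 : ∀ z, g (nb G Finset.univ z).card ≤
      f d (Fintype.card V) - f d (Fintype.card V - (nb G Finset.univ z).card) := by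
    intro z
    have h3 := step d Finset.univ _ (nb_pos G Finset.univ z (Finset.mem_univ z)) (hd _ z)
      (Finset.card_le_card (nb_sub G Finset.univ z))
    rw [Finset.card_univ] at h3
    linarith
  have hle : ∀ z, ∑ u, ∑ v, ∑ w, sg G z u v w ≤ ∑ u, ∑ v, ∑ w, om G z u v w := by
    intro z
    rw [sg_sum]
    linarith [key z, key2 z]
  constructor
  · intro a b c hab hac hne
    by_contra hbc
    have h1 := sum_lt G Finset.univ a b c (Finset.mem_univ _) (Finset.mem_univ _)
      (Finset.mem_univ _) hab hac hne hbc
    exact absurd (Finset.sum_le_sum fun z (_ : z ∈ Finset.univ) => hle z) (not_le.2 h1)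
  · intro z
    have h1 := (Finset.sum_eq_sum_iff_of_le fun z (_ : z ∈ Finset.univ) => hle z).1
      (le_antisymm (Finset.sum_le_sum fun z (_ : z ∈ Finset.univ) => hle z)
        (sum_le G Finset.univ)) z (Finset.mem_univ z)
    rw [sg_sum] at h1
    linarith [key z, key2 z]

lemma tri_eq [Fintype V] : tri G Finset.univ = 6 * ((G.cliqueFinset 3).card : ℤ) := by
  have h0 : tri G Finset.univ =
      ((Finset.univ.filter fun p : V × V × V => T3 G p.1 p.2.1 p.2.2).card : ℤ) := by
    rw [Finset.card_filter, Fintype.sum_prod_type]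
    simp only [Fintype.sum_prod_type, tri]
    push_cast
    rfl
  rw [h0]
  have hmap : ∀ p ∈ (Finset.univ.filter fun p : V × V × V => T3 G p.1 p.2.1 p.2.2),
      ({p.1, p.2.1, p.2.2} : Finset V) ∈ G.cliqueFinset 3 := by
    rintro ⟨a, b, c⟩ hp
    simp only [Finset.mem_filter, Finset.mem_univ, true_and] at hp
    rw [SimpleGraph.mem_cliqueFinset_iff, SimpleGraph.is3Clique_triple_iff]
    exact hp
  rw [Finset.card_eq_sum_card_fiberwise hmap]
  have hf : ∀ s ∈ G.cliqueFinset 3, ((Finset.univ.filter fun p : V × V × V =>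
      T3 G p.1 p.2.1 p.2.2).filter fun p => ({p.1, p.2.1, p.2.2} : Finset V) = s).card = 6 := by
    intro s hs
    rw [SimpleGraph.mem_cliqueFinset_iff, SimpleGraph.is3Clique_iff] at hs
    obtain ⟨a, b, c, hab, hac, hbc, rfl⟩ := hs
    have e : ((Finset.univ.filter fun p : V × V × V =>
      T3 G p.1 p.2.1 p.2.2).filter fun p => ({p.1, p.2.1, p.2.2} : Finset V) = {a, b, c}) =
      {(a, b, c), (a, c, b), (b, a, c), (b, c, a), (c, a, b), (c, b, a)} := by
      ext ⟨x, y, z⟩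
      simp only [Finset.mem_filter, Finset.mem_univ, true_and, Finset.mem_insert,
        Finset.mem_singleton, Prod.mk.injEq]
      constructor
      · rintro ⟨⟨h1, h2, h3⟩, h⟩
        have hx : x ∈ ({a, b, c} : Finset V) := h ▸ by simp
        have hy : y ∈ ({a, b, c} : Finset V) := h ▸ by simp
        have hz : z ∈ ({a, b, c} : Finset V) := h ▸ by simp
        have := h1.ne
        have := h2.ne
        have := h3.ne
        simp only [Finset.mem_insert, Finset.mem_singleton] at hx hy hz
        clear h h1 h2 h3
        grind
      · have := hab.symm
        have := hac.symm
        have := hbc.symm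
        rintro (⟨rfl, rfl, rfl⟩ | ⟨rfl, rfl, rfl⟩ | ⟨rfl, rfl, rfl⟩ | ⟨rfl, rfl, rfl⟩ |
          ⟨rfl, rfl, rfl⟩ | ⟨rfl, rfl, rfl⟩) <;> refine ⟨by simp [T3, *], ?_⟩ <;> ext t <;>
          simp <;> tauto
    rw [e]
    have := hab.ne
    have := hac.ne
    have := hbc.ne
    have := hab.ne'
    have := hac.ne'
    have := hbc.ne'
    simp [*]
  rw [Finset.sum_congr rfl hf]
  simp [mul_comm]

lemma six_choose (m : ℕ) : 6 * (m.choose 3 : ℤ) = g m := by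
  induction m with
  | zero => simp [g]
  | succ k ih =>
    have h2 : 2 * (k.choose 2 : ℤ) = k * (k - 1) := by
      clear ih
      induction k with
      | zero => simp
      | succ k ih => rw [Nat.choose_succ_succ' k 1]; push_cast; simp; linarith
    rw [Nat.choose_succ_succ' k 2]
    simp only [g] at *
    push_cast
    linarith

lemma tri_cluster [Fintype V] (hc : ∀ a b c, G.Adj a b → G.Adj a c → b ≠ c → G.Adj b c) :
    tri G Finset.univ = ∑ v, (G.degree v : ℤ) * (G.degree v - 1) := by
  rw [tri]
  refine Finset.sum_congr rfl fun u _ => ?_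
  have h : ∀ v ∈ G.neighborFinset u, ∑ w, (if T3 G u v w then (1 : ℤ) else 0) =
      G.degree u - 1 := by
    intro v hv
    rw [← SimpleGraph.card_neighborFinset_eq_degree, ← count2 _ v hv,
      SimpleGraph.neighborFinset_eq_filter, Finset.sum_filter]
    rw [SimpleGraph.mem_neighborFinset] at hv
    refine Finset.sum_congr rfl fun w _ => ?_
    by_cases h1 : G.Adj u w
    · rw [if_pos h1]
      refine if_congr ⟨fun h => h.2.2.ne, fun h => ⟨hv, h1, hc u v w hv h1 h⟩⟩ rfl rfl
    · simp [h1]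
  have e : ∑ v, ∑ w, (if T3 G u v w then (1 : ℤ) else 0) =
      ∑ v ∈ G.neighborFinset u, ∑ w, (if T3 G u v w then (1 : ℤ) else 0) := by
    symm
    apply Finset.sum_subset (Finset.subset_univ _)
    intro v _ hv
    rw [SimpleGraph.mem_neighborFinset] at hv
    exact Finset.sum_eq_zero fun w _ => by simp [hv]
  rw [e, Finset.sum_congr rfl h, Finset.sum_const, SimpleGraph.card_neighborFinset_eq_degree,
    nsmul_eq_mul]

lemma nb_card [Fintype V] (z : V) : (nb G Finset.univ z).card = G.degree z + 1 := by
  have : nb G Finset.univ z = insert z (G.neighborFinset z) := by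
    ext x; simp [nb, R, eq_comm]
  rw [this, Finset.card_insert_of_notMem (by simp), SimpleGraph.card_neighborFinset_eq_degree]

end graph

lemma equiv_of_classes {W : Type*} [Fintype W] (s : Setoid W) (q m : ℕ) (hm : 0 < m)
    (hW : Fintype.card W = q * m) (hs : ∀ x, Nat.card {y // s x y} = m) :
    ∃ e : W ≃ Fin q × Fin m, ∀ x y, s x y ↔ (e x).1 = (e y).1 := by
  classical
  have hfib : ∀ c : Quotient s, Nonempty ({y // Quotient.mk s y = c} ≃ Fin m) := by
    intro c
    induction c using Quotient.inductionOn with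
    | _ x =>
    refine ⟨(Equiv.subtypeEquivRight fun y => ?_).trans (Finite.equivFinOfCardEq (hs x))⟩
    rw [Quotient.eq]
    exact ⟨s.symm, s.symm⟩
  have φ := fun c => (hfib c).some
  let e₁ : W ≃ Quotient s × Fin m :=
    ((Equiv.sigmaFiberEquiv (Quotient.mk s)).symm.trans (Equiv.sigmaCongrRight φ)).trans
      (Equiv.sigmaEquivProd _ _)
  have he₁ : ∀ x, (e₁ x).1 = Quotient.mk s x := fun x => rfl
  have hq : Fintype.card (Quotient s) = q := by
    have := Fintype.card_congr e₁
    rw [hW, Fintype.card_prod, Fintype.card_fin] at this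
    exact (Nat.eq_of_mul_eq_mul_right hm this).symm
  let e₂ : Quotient s ≃ Fin q := Fintype.equivFinOfCardEq hq
  refine ⟨e₁.trans (e₂.prodCongr (Equiv.refl _)), fun x y => ?_⟩
  have : ∀ x, ((e₁.trans (e₂.prodCongr (Equiv.refl _))) x).1 = e₂ (Quotient.mk s x) :=
    fun x => rfl
  rw [this, this, e₂.apply_eq_iff_eq, Quotient.eq]

end ExtremalAux

open ExtremalAux in
/-- **Uniqueness of the extremal graph for `r ≥ 3`.** If `n = q*(d+1) + r` with `3 ≤ r ≤ d`
and a graph on `n` vertices with maximum degree at most `d` has exactly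
`q * C(d+1,3) + C(r,3)` triangles, then it is isomorphic to the disjoint union
`q K_{d+1} ⊔ K_r` of `q` copies of `K_{d+1}` and one copy of `K_r` (encoded here as the graph
on `(Fin q × Fin (d+1)) ⊕ Fin r` in which two distinct vertices are adjacent iff they lie
in the same part). -/
theorem extremal_graph_unique
    (n d q r : ℕ) (hn : 1 ≤ n) (hd : 1 ≤ d)
    (hqr : n = q * (d + 1) + r) (hr3 : 3 ≤ r) (hrd : r ≤ d)
    (V : Type*) [Fintype V] [DecidableEq V] (hcard : Fintype.card V = n)
    (G : SimpleGraph V) [DecidableRel G.Adj]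
    (hdeg : ∀ v : V, G.degree v ≤ d)
    (htri : (G.cliqueFinset 3).card = q * (d + 1).choose 3 + r.choose 3) :
    Nonempty (G ≃g SimpleGraph.fromRel
      (fun x y : (Fin q × Fin (d + 1)) ⊕ Fin r =>
        Sum.elim (fun p => (p.1 : ℕ)) (fun _ => q) x
          = Sum.elim (fun p => (p.1 : ℕ)) (fun _ => q) y)) := by
  classical
  have hcardV : Fintype.card V = q * (d + 1) + r := hcard.trans hqr
  have hdn : ∀ S z, (nb G S z).card ≤ d + 1 := by
    intro S z
    have h1 : (nb G S z).card ≤ (nb G Finset.univ z).card :=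
      Finset.card_le_card (Finset.filter_subset_filter _ (Finset.subset_univ S))
    have h2 := nb_card G z
    have h3 := hdeg z
    omega
  have ht : tri G Finset.univ = q * g (d + 1) + g r := by
    rw [tri_eq, htri, ← six_choose, ← six_choose]
    push_cast
    ring
  obtain ⟨hc, hz⟩ := structure_lemma G d hdn (by rw [ht, hcardV, f_eq d q r hrd])
  have hdr : ∀ z, G.degree z = d ∨ G.degree z = r - 1 := by
    intro z
    by_contra! hcon
    have h1 := hz z
    have h2 : (nb G Finset.univ z).card ≤ Fintype.card V :=
      Finset.card_le_card (nb_sub G Finset.univ z)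
    rw [nb_card, hcardV] at h1 h2
    have h3 := (arith d q r (G.degree z + 1) hrd (by omega) (by have := hdeg z; omega) h2).2 hr3
      (by omega) (by omega)
    rw [h1, f_eq d q r hrd] at h3
    exact lt_irrefl _ h3
  have hm : (Finset.univ.filter fun v => G.degree v = r - 1).card = r := by
    have h1 := tri_cluster G hc
    have h2 : ∀ v, (G.degree v : ℤ) * (G.degree v - 1) = (d : ℤ) * (d - 1) -
        (if G.degree v = r - 1 then 1 else 0) * ((d : ℤ) * (d - 1) - (r - 1) * (r - 2)) := by
      intro v
      split_ifs with h
      · rw [h]; push_cast [show 1 ≤ r by omega]; ring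
      · rw [(hdr v).resolve_right h]; ring
    rw [Finset.sum_congr rfl fun v _ => h2 v, Finset.sum_sub_distrib, Finset.sum_const,
      ← Finset.sum_mul, Finset.sum_boole, ht, Finset.card_univ, hcardV, nsmul_eq_mul] at h1
    set m := (Finset.univ.filter fun v => G.degree v = r - 1).card
    simp only [g] at h1
    push_cast at h1
    have h3 : ((m : ℤ) - r) * (((d : ℤ) - (r - 1)) * (d + r - 2)) = 0 := by
      linear_combination h1
    have h4 : (((d : ℤ) - (r - 1)) * (d + r - 2)) ≠ 0 := by
      apply mul_ne_zero <;> omega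
    have h5 := (mul_eq_zero.1 h3).resolve_right h4
    omega
  have hsymm : ∀ {x y}, R G x y → R G y x := by
    rintro x y (rfl | h)
    · exact Or.inl rfl
    · exact Or.inr h.symm
  have htrans : ∀ {x y z}, R G x y → R G y z → R G x z := by
    rintro x y z (rfl | h) (rfl | h')
    · exact Or.inl rfl
    · exact Or.inr h'
    · exact Or.inr h
    · by_cases hxz : x = z
      · exact Or.inl hxz
      · exact Or.inr (hc y x z h.symm h' hxz)
  have hRdeg : ∀ {x y}, R G x y → G.degree x = G.degree y := by
    intro x y h
    have h1 := nb_card G x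
    have h2 := nb_card G y
    have : nb G Finset.univ x = nb G Finset.univ y := by
      ext z
      simp only [nb, Finset.mem_filter, Finset.mem_univ, true_and]
      exact ⟨fun h' => htrans (hsymm h) h', fun h' => htrans h h'⟩
    rw [this] at h1
    omega
  have hA : ∀ x y, G.degree x = r - 1 → G.degree y = r - 1 → R G x y := by
    intro x y hx hy
    have hsub : nb G Finset.univ x ⊆ Finset.univ.filter fun v => G.degree v = r - 1 := by
      intro z hz
      simp only [nb, Finset.mem_filter, Finset.mem_univ, true_and] at hz ⊢
      rw [← hRdeg hz, hx]
    have heq := Finset.eq_of_subset_of_card_le hsub (by rw [hm, nb_card, hx]; omega)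
    have : y ∈ nb G Finset.univ x := by
      rw [heq]; simp [hy]
    simpa only [nb, Finset.mem_filter, Finset.mem_univ, true_and] using this
  let s : Setoid {v // ¬ G.degree v = r - 1} :=
    { r := fun x y => R G x.1 y.1
      iseqv := ⟨fun _ => Or.inl rfl, fun h => hsymm h, fun h h' => htrans h h'⟩ }
  have hcA : Fintype.card {v // G.degree v = r - 1} = r := by
    rw [Fintype.card_subtype, hm]
  obtain ⟨e, he⟩ := equiv_of_classes s q (d + 1) (by omega)
    (by rw [Fintype.card_subtype_compl, hcA, hcardV]; omega) (by
      intro x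
      have h1 := nb_card G x.1
      rw [(hdr x.1).resolve_right x.2] at h1
      rw [← h1, Nat.card_eq_fintype_card, ← Fintype.card_coe]
      refine Fintype.card_congr ⟨fun y => ⟨y.1.1, ?_⟩, fun y => ⟨⟨y.1, ?_⟩, ?_⟩, fun _ => rfl,
        fun _ => rfl⟩
      · have h2 : R G x.1 y.1.1 := y.2
        simp only [nb, Finset.mem_filter, Finset.mem_univ, true_and]
        exact h2
      · have h2 := y.2
        simp only [nb, Finset.mem_filter, Finset.mem_univ, true_and] at h2
        rw [← hRdeg h2]
        exact x.2
      · have h2 := y.2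
        simp only [nb, Finset.mem_filter, Finset.mem_univ, true_and] at h2
        exact h2)
  let eA : {v // G.degree v = r - 1} ≃ Fin r := Fintype.equivFinOfCardEq hcA
  let E : V ≃ (Fin q × Fin (d + 1)) ⊕ Fin r :=
    (Equiv.sumCompl fun v => G.degree v = r - 1).symm.trans
      ((Equiv.sumComm _ _).trans (Equiv.sumCongr e eA))
  have hE1 : ∀ v (h : G.degree v = r - 1), E v = Sum.inr (eA ⟨v, h⟩) := by
    intro v h
    have h' := Equiv.sumCompl_symm_apply_of_pos (p := fun v => G.degree v = r - 1) h
    simp [E, h']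
  have hE2 : ∀ v (h : ¬ G.degree v = r - 1), E v = Sum.inl (e ⟨v, h⟩) := by
    intro v h
    have h' := Equiv.sumCompl_symm_apply_of_neg (p := fun v => G.degree v = r - 1) h
    simp [E, h']
  refine ⟨⟨E, ?_⟩⟩
  intro x y
  rw [SimpleGraph.fromRel_adj, E.injective.ne_iff]
  have hR : G.Adj x y ↔ x ≠ y ∧ R G x y :=
    ⟨fun h => ⟨h.ne, Or.inr h⟩, fun h => h.2.resolve_left h.1⟩
  rw [hR]
  refine and_congr_right fun _ => ?_
  rw [eq_comm, or_self]
  by_cases hx : G.degree x = r - 1 <;> by_cases hy : G.degree y = r - 1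
  · rw [hE1 x hx, hE1 y hy]
    simpa using hA x y hx hy
  · rw [hE1 x hx, hE2 y hy]
    have h1 : ¬ R G x y := fun h => hy (by rw [← hRdeg h, hx])
    have h2 := (e ⟨y, hy⟩).1.2
    simp only [h1, iff_false, Sum.elim_inl, Sum.elim_inr]
    omega
  · rw [hE2 x hx, hE1 y hy]
    have h1 : ¬ R G x y := fun h => hx (by rw [hRdeg h, hy])
    have h2 := (e ⟨x, hx⟩).1.2
    simp only [h1, iff_false, Sum.elim_inl, Sum.elim_inr]
    omega
  · rw [hE2 x hx, hE2 y hy]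
    have h1 := he ⟨x, hx⟩ ⟨y, hy⟩
    have h2 : s ⟨x, hx⟩ ⟨y, hy⟩ ↔ R G x y := Iff.rfl
    rw [← h2, h1, Fin.ext_iff]
    simp only [Sum.elim_inl]
    exact eq_comm
end
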